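/- Assume f_ρ(β) > 0. Then every positive sub-solution u of equation (E) in Ω∖{0} satisfies limsup_{|x|→0} |x|^β u(x) ≤ Λ. -/

import Mathlib

open MeasureTheory Filter Topology Real RealInnerProductSpace

noncomputable section

/-- The gradient factor `G_τ(x,z,ξ) = z^τ ‖ξ‖^(1-τ) / ‖x‖^(τ+1)`.
For `τ = 0` this equals `‖ξ‖ / ‖x‖`, since `z ^ (0:ℝ) = 1` for real powers. -/
def Gt {N : ℕ} (τ : ℝ) (x : EuclideanSpace ℝ (Fin N)) (z : ℝ)
    (ξ : EuclideanSpace ℝ (Fin N)) : ℝ :=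
  z ^ τ * ‖ξ‖ ^ (1 - τ) / ‖x‖ ^ (τ + 1)

/-- Test functions: `C¹` functions with compact support contained in `Ω \ {0}`. -/
def IsTestFun {N : ℕ} (Ω : Set (EuclideanSpace ℝ (Fin N)))
    (φ : EuclideanSpace ℝ (Fin N) → ℝ) : Prop :=
  ContDiff ℝ 1 φ ∧ HasCompactSupport φ ∧ tsupport φ ⊆ Ω \ {0}

/-- The distributional pairing of equation (E) with a test function `φ`:
`∫ ∇u·∇φ + (N-2+2ρ) ∫ ((x·∇u)/|x|²) φ - λ ∫ G_τ(x,u,∇u) φ + ∫ |x|^θ u^q φ`. -/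
def weakE (N : ℕ) (ρ lam τ θ q : ℝ) (Ω : Set (EuclideanSpace ℝ (Fin N)))
    (u φ : EuclideanSpace ℝ (Fin N) → ℝ) : ℝ :=
  (∫ x in Ω \ {0}, ⟪gradient u x, gradient φ x⟫)
    + ((N : ℝ) - 2 + 2 * ρ) * (∫ x in Ω \ {0}, ⟪x, gradient u x⟫ / ‖x‖ ^ 2 * φ x)
    - lam * (∫ x in Ω \ {0}, Gt τ x (u x) (gradient u x) * φ x)
    + ∫ x in Ω \ {0}, ‖x‖ ^ θ * u x ^ q * φ x

/-- A positive `C¹` function on `Ω \ {0}`. -/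
def PosC1 {N : ℕ} (Ω : Set (EuclideanSpace ℝ (Fin N)))
    (u : EuclideanSpace ℝ (Fin N) → ℝ) : Prop :=
  ContDiffOn ℝ 1 u (Ω \ {0}) ∧ ∀ x ∈ Ω \ {0}, 0 < u x

/-- Positive distributional solution of equation (E) in `Ω \ {0}`. -/
def IsSolutionE (N : ℕ) (ρ lam τ θ q : ℝ) (Ω : Set (EuclideanSpace ℝ (Fin N)))
    (u : EuclideanSpace ℝ (Fin N) → ℝ) : Prop :=
  PosC1 Ω u ∧ ∀ φ, IsTestFun Ω φ → weakE N ρ lam τ θ q Ω u φ = 0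

/-- Positive sub-solution of equation (E) in `Ω \ {0}`. -/
def IsSubSolutionE (N : ℕ) (ρ lam τ θ q : ℝ) (Ω : Set (EuclideanSpace ℝ (Fin N)))
    (u : EuclideanSpace ℝ (Fin N) → ℝ) : Prop :=
  PosC1 Ω u ∧ ∀ φ, IsTestFun Ω φ → (∀ x, 0 ≤ φ x) → weakE N ρ lam τ θ q Ω u φ ≤ 0

/-- Positive super-solution of equation (E) in `Ω \ {0}`. -/
def IsSuperSolutionE (N : ℕ) (ρ lam τ θ q : ℝ) (Ω : Set (EuclideanSpace ℝ (Fin N)))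
    (u : EuclideanSpace ℝ (Fin N) → ℝ) : Prop :=
  PosC1 Ω u ∧ ∀ φ, IsTestFun Ω φ → (∀ x, 0 ≤ φ x) → 0 ≤ weakE N ρ lam τ θ q Ω u φ

/-- `f_ρ(t) = t (t + 2ρ) + λ |t|^(1-τ)`. -/
def fRho (ρ lam τ t : ℝ) : ℝ := t * (t + 2 * ρ) + lam * |t| ^ (1 - τ)

/-- `Υ = ((τ+1)/(2τ)) (λτ)^(1/(τ+1))`. -/
def Upsilon (lam τ : ℝ) : ℝ := ((τ + 1) / (2 * τ)) * (lam * τ) ^ (1 / (τ + 1))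

/-- Case [N₀]: (a) `τ = 0` and `λ ≥ 2ρ`, or (b) `λ > 0`, `τ ∈ (0,1)` and `ρ < Υ`. -/
def CaseN0 (ρ lam τ : ℝ) : Prop :=
  (τ = 0 ∧ 2 * ρ ≤ lam) ∨ (0 < lam ∧ 0 < τ ∧ τ < 1 ∧ ρ < Upsilon lam τ)

/-- Case [N₁]: (a) `τ = 0` and `λ < 2ρ`, or (b) `λ < 0` and `τ ∈ (0,1)`. -/
def CaseN1 (ρ lam τ : ℝ) : Prop :=
  (τ = 0 ∧ lam < 2 * ρ) ∨ (lam < 0 ∧ 0 < τ ∧ τ < 1)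

/-- Case [N₂]: `λ > 0`, `τ ∈ (0,1)` and `ρ ≥ Υ`. -/
def CaseN2 (ρ lam τ : ℝ) : Prop :=
  0 < lam ∧ 0 < τ ∧ τ < 1 ∧ Upsilon lam τ ≤ ρ

/-- `w` is the smallest negative root of `f_ρ` (i.e. `w = ϖ₁`). -/
def IsMinNegRoot (ρ lam τ w : ℝ) : Prop :=
  w < 0 ∧ fRho ρ lam τ w = 0 ∧ ∀ t, t < 0 → fRho ρ lam τ t = 0 → w ≤ t

/-- `w` is the largest negative root of `f_ρ` (i.e. `w = ϖ₂`). -/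
def IsMaxNegRoot (ρ lam τ w : ℝ) : Prop :=
  w < 0 ∧ fRho ρ lam τ w = 0 ∧ ∀ t, t < 0 → fRho ρ lam τ t = 0 → t ≤ w

/-- `Φ_{ϖ₂}(r)`: equal to `r^(-ϖ₂)` if `ρ > Υ` and to `r^(-ϖ₂) |log r|^(2/(1+τ))` if `ρ = Υ`. -/
def Phi2 (ρ lam τ w2 r : ℝ) : ℝ :=
  if ρ = Upsilon lam τ then r ^ (-w2) * |Real.log r| ^ (2 / (1 + τ)) else r ^ (-w2)

/-- `Ψ_{ϖ₁}(t)`: equal to `t^(-ϖ₁)` if `ρ > Υ` and to `t^(-ϖ₁) (log t)^(2/(1+τ))` if `ρ = Υ`. -/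
def Psi1 (ρ lam τ w1 t : ℝ) : ℝ :=
  if ρ = Upsilon lam τ then t ^ (-w1) * (Real.log t) ^ (2 / (1 + τ)) else t ^ (-w1)

/-- The radial operator `L_{ρ,λ,τ}[P](r) = P'' + (1-2ρ) P'/r + λ P^τ |P'|^(1-τ)/r^(1+τ)`. -/
def Lrad (ρ lam τ : ℝ) (P : ℝ → ℝ) (r : ℝ) : ℝ :=
  deriv (deriv P) r + (1 - 2 * ρ) * deriv P r / r
    + lam * P r ^ τ * |deriv P r| ^ (1 - τ) / r ^ (1 + τ)

/-- The Laplacian of `u` at `x`, as the trace of the second derivative. -/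
def lapl {N : ℕ} (u : EuclideanSpace ℝ (Fin N) → ℝ) (x : EuclideanSpace ℝ (Fin N)) : ℝ :=
  ∑ i : Fin N, iteratedFDeriv ℝ 2 u x ![EuclideanSpace.single i 1, EuclideanSpace.single i 1]

/-- The divergence of a vector field on Euclidean space. -/
def divergence {N : ℕ} (Y : EuclideanSpace ℝ (Fin N) → EuclideanSpace ℝ (Fin N))
    (x : EuclideanSpace ℝ (Fin N)) : ℝ :=
  ∑ i, fderiv ℝ Y x (EuclideanSpace.single i 1) i

lemma continuous_mul_of_tsupport_subset {X : Type*} [TopologicalSpace X] {g φ : X → ℝ} {U : Set X}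
    (hU : IsOpen U) (hg : ContinuousOn g U) (hφ : Continuous φ) (hs : tsupport φ ⊆ U) :
    Continuous fun x => g x * φ x := by
  refine continuous_of_tsupport fun x hx => ?_
  have hxU : x ∈ U := hs (closure_mono (Function.support_mul_subset_right g φ) hx)
  exact (hg.continuousAt (hU.mem_nhds hxU)).mul hφ.continuousAt

lemma integrable_mul_of_tsupport_subset {N : ℕ} {g φ : EuclideanSpace ℝ (Fin N) → ℝ}
    {U : Set (EuclideanSpace ℝ (Fin N))} (hU : IsOpen U) (hg : ContinuousOn g U)
    (hφ : Continuous φ) (hc : HasCompactSupport φ) (hs : tsupport φ ⊆ U) :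
    Integrable fun x => g x * φ x :=
  (continuous_mul_of_tsupport_subset hU hg hφ hs).integrable_of_hasCompactSupport hc.mul_left

section IntegrationByParts

variable {N : ℕ} {Y : EuclideanSpace ℝ (Fin N) → EuclideanSpace ℝ (Fin N)}
  {φ : EuclideanSpace ℝ (Fin N) → ℝ} {U : Set (EuclideanSpace ℝ (Fin N))}

lemma inner_gradient_eq_sum (Z : EuclideanSpace ℝ (Fin N)) (x : EuclideanSpace ℝ (Fin N)) :
    ⟪Z, gradient φ x⟫ = ∑ i, Z i * fderiv ℝ φ x (EuclideanSpace.single i 1) := by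
  simp only [← inner_gradient_left, EuclideanSpace.inner_single_right, one_mul, conj_trivial]
  simp only [PiLp.inner_apply, RCLike.inner_apply, conj_trivial, mul_comm]

lemma integrable_mul_fderiv_single (hU : IsOpen U) (hY : ContinuousOn Y U)
    (hφ : ContDiff ℝ 1 φ) (hc : HasCompactSupport φ) (hs : tsupport φ ⊆ U) (i : Fin N) :
    Integrable fun x => Y x i * fderiv ℝ φ x (EuclideanSpace.single i 1) := by
  refine integrable_mul_of_tsupport_subset hU
    (by fun_prop) ((hφ.continuous_fderiv one_ne_zero).clm_apply continuous_const)
    (hc.fderiv_apply ℝ _) ((tsupport_fderiv_apply_subset ℝ _).trans hs)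

lemma integrable_inner_gradient (hU : IsOpen U) (hY : ContinuousOn Y U)
    (hφ : ContDiff ℝ 1 φ) (hc : HasCompactSupport φ) (hs : tsupport φ ⊆ U) :
    Integrable fun x => ⟪Y x, gradient φ x⟫ := by
  simp only [inner_gradient_eq_sum]
  exact integrable_finsetSum _ fun i _ => integrable_mul_fderiv_single hU hY hφ hc hs i

lemma continuousOn_fderiv_single (hU : IsOpen U) (hY : ContDiffOn ℝ 1 Y U) (i : Fin N) :
    ContinuousOn (fun x => fderiv ℝ Y x (EuclideanSpace.single i 1) i) U := by
  have := hY.continuousOn_fderiv_of_isOpen hU le_rfl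
  fun_prop

lemma continuousOn_divergence (hU : IsOpen U) (hY : ContDiffOn ℝ 1 Y U) :
    ContinuousOn (divergence Y) U :=
  continuousOn_finsetSum _ fun i _ => continuousOn_fderiv_single hU hY i

lemma fderiv_coord {x v : EuclideanSpace ℝ (Fin N)} (h : DifferentiableAt ℝ Y x) (i : Fin N) :
    fderiv ℝ (fun y => Y y i) x v = fderiv ℝ Y x v i := by
  have := ((EuclideanSpace.proj i : EuclideanSpace ℝ (Fin N) →L[ℝ] ℝ).hasFDerivAt.comp x
    h.hasFDerivAt).fderiv
  rw [show (fun y => Y y i) = (EuclideanSpace.proj i : EuclideanSpace ℝ (Fin N) →L[ℝ] ℝ) ∘ Y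
    from rfl, this]
  rfl

lemma integral_inner_gradient_eq_neg_integral_divergence (hU : IsOpen U) (hY : ContDiffOn ℝ 1 Y U)
    (hφ : ContDiff ℝ 1 φ) (hc : HasCompactSupport φ) (hs : tsupport φ ⊆ U) :
    ∫ x, ⟪Y x, gradient φ x⟫ = -∫ x, divergence Y x * φ x := by
  have hd : ∀ x ∈ U, DifferentiableAt ℝ Y x := fun x hx =>
    (hY.differentiableOn one_ne_zero).differentiableAt (hU.mem_nhds hx)
  have hco : ∀ (i : Fin N) x, fderiv ℝ (fun y => Y y i) x (EuclideanSpace.single i 1) * φ x =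
      fderiv ℝ Y x (EuclideanSpace.single i 1) i * φ x := by
    intro i x
    by_cases hx : x ∈ tsupport φ
    · rw [fderiv_coord (hd x (hs hx))]
    · simp [image_eq_zero_of_notMem_tsupport hx]
  have hint : ∀ i : Fin N,
      Integrable fun x => fderiv ℝ Y x (EuclideanSpace.single i 1) i * φ x := fun i =>
    integrable_mul_of_tsupport_subset hU (continuousOn_fderiv_single hU hY i) hφ.continuous hc hs
  have key : ∀ i : Fin N, ∫ x, Y x i * fderiv ℝ φ x (EuclideanSpace.single i 1) =
      -∫ x, fderiv ℝ Y x (EuclideanSpace.single i 1) i * φ x := by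
    intro i
    simp only [← hco i]
    refine integral_mul_fderiv_eq_neg_fderiv_mul_of_integrable (f := fun x => Y x i) ?_
      (integrable_mul_fderiv_single hU hY.continuousOn hφ hc hs i)
      (integrable_mul_of_tsupport_subset hU ?_ hφ.continuous hc hs)
      (fun x hx => ?_) fun x _ => hφ.differentiable one_ne_zero x
    · simpa only [hco i] using hint i
    · have := hY.continuousOn
      fun_prop
    · have := hd x (hs hx)
      fun_prop
  simp only [inner_gradient_eq_sum, divergence, Finset.sum_mul]
  rw [integral_finsetSum _ fun i _ => integrable_mul_fderiv_single hU hY.continuousOn hφ hc hs i,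
    integral_finsetSum _ fun i _ => hint i, ← Finset.sum_neg_distrib]
  exact Finset.sum_congr rfl fun i _ => key i

end IntegrationByParts

section TouchingFromAbove

variable {N : ℕ} {U : Set (EuclideanSpace ℝ (Fin N))}

lemma contDiffOn_gradient {V : EuclideanSpace ℝ (Fin N) → ℝ} (hU : IsOpen U)
    (hV : ContDiffOn ℝ 2 V U) : ContDiffOn ℝ 1 (gradient V) U :=
  (InnerProductSpace.toDual ℝ (EuclideanSpace ℝ (Fin N))).symm.contDiff.comp_contDiffOn
    (hV.fderiv_of_isOpen hU (by norm_num))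

lemma continuousOn_gradient {u : EuclideanSpace ℝ (Fin N) → ℝ} (hU : IsOpen U)
    (hu : ContDiffOn ℝ 1 u U) : ContinuousOn (gradient u) U :=
  (InnerProductSpace.toDual ℝ (EuclideanSpace ℝ (Fin N))).symm.continuous.comp_continuousOn
    (hu.continuousOn_fderiv_of_isOpen hU le_rfl)

lemma divergence_add_smul_sub {Y : EuclideanSpace ℝ (Fin N) → EuclideanSpace ℝ (Fin N)}
    {x : EuclideanSpace ℝ (Fin N)} (h : DifferentiableAt ℝ Y x) (a : ℝ)
    (x₀ : EuclideanSpace ℝ (Fin N)) :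
    divergence (fun y => Y y + a • (y - x₀)) x = divergence Y x + N * a := by
  have : HasFDerivAt (fun y => Y y + a • (y - x₀))
      (fderiv ℝ Y x + a • ContinuousLinearMap.id ℝ _) x :=
    h.hasFDerivAt.add (((hasFDerivAt_id x).sub_const x₀).const_smul a)
  simp [divergence, this.fderiv, Finset.sum_add_distrib]

/-- If a `C²` function `V` touches from above, at `x₀`, a `C¹` function `u` with `-Δu ≤ B` weakly,
then `-ΔV ≤ B` at `x₀`. -/
lemma neg_divergence_gradient_le_of_touching {u V B : EuclideanSpace ℝ (Fin N) → ℝ}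
    {x₀ : EuclideanSpace ℝ (Fin N)} (hU : IsOpen U) (hx₀ : x₀ ∈ U)
    (hu : ContDiffOn ℝ 1 u U) (hV : ContDiffOn ℝ 2 V U) (hB : ContinuousOn B U)
    (hweak : ∀ φ : EuclideanSpace ℝ (Fin N) → ℝ, ContDiff ℝ 1 φ → HasCompactSupport φ →
      tsupport φ ⊆ U → (∀ x, 0 ≤ φ x) → ∫ x, ⟪gradient u x, gradient φ x⟫ ≤ ∫ x, B x * φ x)
    (hle : ∀ x ∈ U, u x ≤ V x) (heq : u x₀ = V x₀) :
    -divergence (gradient V) x₀ ≤ B x₀ := by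
  by_contra! hlt
  have hgV := contDiffOn_gradient hU hV
  have hD := continuousOn_divergence hU hgV
  obtain ⟨δ, hδ, hδ'⟩ : ∃ δ : ℝ, 0 < δ ∧ divergence (gradient V) x₀ + B x₀ < -δ :=
    ⟨-(divergence (gradient V) x₀ + B x₀) / 2, by linarith, by linarith⟩
  obtain ⟨r, hr, hball⟩ : ∃ r > 0, ∀ x ∈ Metric.ball x₀ r,
      x ∈ U ∧ divergence (gradient V) x + B x < -δ := by
    have hcont := (hD.add hB).continuousAt (hU.mem_nhds hx₀)
    exact Metric.eventually_nhds_iff_ball.1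
      ((hU.eventually_mem hx₀).and (hcont.eventually_lt continuousAt_const hδ'))
  obtain ⟨η, hη, hηN⟩ : ∃ η : ℝ, 0 < η ∧ N * (2 * η) < δ := by
    have hN : (0 : ℝ) ≤ N := N.cast_nonneg
    refine ⟨δ / (2 * (N + 1)), by positivity, ?_⟩
    have : (N : ℝ) * (2 * (δ / (2 * (N + 1)))) = δ * (N / (N + 1)) := by field_simp
    rw [this]
    have : (N : ℝ) / (N + 1) < 1 := by rw [div_lt_one (by positivity)]; linarith
    nlinarith
  have hbU : Metric.ball x₀ r ⊆ U := fun x hx => (hball x hx).1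
  set h : EuclideanSpace ℝ (Fin N) → ℝ :=
    fun x => u x - V x - η * ‖x - x₀‖ ^ 2 + η * (r / 2) ^ 2 with hh
  set φ : EuclideanSpace ℝ (Fin N) → ℝ :=
    (Metric.ball x₀ r).indicator fun x => smoothTransition (h x) with hφdef
  set Y : EuclideanSpace ℝ (Fin N) → EuclideanSpace ℝ (Fin N) :=
    fun y => gradient V y + (2 * η) • (y - x₀) with hYdef
  have hφ0 : ∀ x, 0 ≤ φ x :=
    fun x => Set.indicator_nonneg (fun y _ => smoothTransition.nonneg (h y)) x
  have hsupp : tsupport φ ⊆ Metric.closedBall x₀ (r / 2) := by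
    refine closure_minimal (fun x hx => ?_) Metric.isClosed_closedBall
    have hxb : x ∈ Metric.ball x₀ r := Set.mem_of_indicator_ne_zero hx
    rw [Function.mem_support, hφdef, Set.indicator_of_mem hxb, Ne,
      smoothTransition.zero_iff_nonpos, not_le] at hx
    have h1 := hle x (hbU hxb)
    rw [Metric.mem_closedBall, dist_eq_norm]
    have h2 : η * ‖x - x₀‖ ^ 2 < η * (r / 2) ^ 2 := by
      simp only [hh] at hx
      linarith
    exact le_of_lt (lt_of_pow_lt_pow_left₀ 2 (by positivity) (lt_of_mul_lt_mul_left h2 hη.le))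
  have hsuppb : tsupport φ ⊆ Metric.ball x₀ r :=
    hsupp.trans (Metric.closedBall_subset_ball (by linarith))
  have hc : HasCompactSupport φ :=
    (isCompact_closedBall x₀ (r / 2)).of_isClosed_subset (isClosed_tsupport φ) hsupp
  have hhC : ∀ x ∈ Metric.ball x₀ r, ContDiffAt ℝ 1 h x := by
    intro x hx
    have hn := hU.mem_nhds (hbU hx)
    have h1 := hu.contDiffAt hn
    have h2 : ContDiffAt ℝ 1 V x := (hV.contDiffAt hn).of_le (by norm_num)
    have h3 : ContDiffAt ℝ 1 (fun x => ‖x - x₀‖ ^ 2) x :=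
      ((contDiff_id.sub contDiff_const).norm_sq ℝ).contDiffAt
    exact ((h1.sub h2).sub (contDiffAt_const.mul h3)).add contDiffAt_const
  have hφeq : ∀ x ∈ Metric.ball x₀ r, φ =ᶠ[𝓝 x] smoothTransition ∘ h := fun x hx =>
    Filter.eventuallyEq_of_mem (Metric.isOpen_ball.mem_nhds hx)
      fun y hy => Set.indicator_of_mem hy _
  have hφC : ContDiff ℝ 1 φ := by
    refine contDiff_iff_contDiffAt.2 fun x => ?_
    by_cases hx : x ∈ tsupport φ
    · exact ((smoothTransition.contDiffAt (n := 1)).comp x (hhC x (hsuppb hx))).congr_of_eventuallyEq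
        (hφeq x (hsuppb hx))
    · exact contDiffAt_const.congr_of_eventuallyEq (notMem_tsupport_iff_eventuallyEq.1 hx)
  have hYC : ContDiffOn ℝ 1 Y U :=
    hgV.add (ContDiff.contDiffOn (by fun_prop))
  have hpoint : ∀ x, 0 ≤ ⟪gradient u x - Y x, gradient φ x⟫ := by
    intro x
    by_cases hx : x ∈ tsupport φ
    · have hxb := hsuppb hx
      have hn := hU.mem_nhds (hbU hxb)
      have h1 := (hu.differentiableOn one_ne_zero).differentiableAt hn
      have h2 := (hV.differentiableOn two_ne_zero).differentiableAt hn
      have hder : HasFDerivAt h (innerSL ℝ (gradient u x - Y x)) x := by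
        have h3 : HasFDerivAt (fun y => ‖y - x₀‖ ^ 2) (2 • innerSL ℝ (x - x₀)) x := by
          simpa using ((hasFDerivAt_id x).sub_const x₀).norm_sq
        refine (((h1.hasFDerivAt.sub h2.hasFDerivAt).sub (h3.const_mul η)).add_const
          (η * (r / 2) ^ 2)).congr_fderiv ?_
        ext v
        simp only [hYdef, inner_gradient_left, sub_apply,
          smul_apply, innerSL_apply_apply, inner_sub_left, inner_add_left,
          real_inner_smul_left, smul_eq_mul, nsmul_eq_mul, Nat.cast_ofNat]
        ring
      have hp : HasDerivAt smoothTransition (deriv smoothTransition (h x)) (h x) :=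
        ((smoothTransition.contDiff (n := 1)).differentiable one_ne_zero _).hasDerivAt
      have hφd : HasFDerivAt φ _ x :=
        (hp.comp_hasFDerivAt x hder).congr_of_eventuallyEq (hφeq x hxb)
      rw [real_inner_comm, inner_gradient_left, hφd.fderiv]
      simp only [smul_apply, innerSL_apply_apply, smul_eq_mul]
      exact mul_nonneg smoothTransition.monotone.deriv_nonneg real_inner_self_nonneg
    · have : gradient φ x = 0 := by
        rw [(notMem_tsupport_iff_eventuallyEq.1 hx).gradient_eq]
        exact gradient_fun_const x (0 : ℝ)
      simp [this]
  have hsU := hsuppb.trans hbU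
  have hguC := continuousOn_gradient hU hu
  have hdivC := continuousOn_divergence hU hYC
  have hnonneg : 0 ≤ ∫ x, (B x + divergence Y x) * φ x := by
    have h1 := integral_nonneg (μ := volume) (Pi.le_def.2 hpoint)
    simp only [inner_sub_left] at h1
    rw [integral_sub (integrable_inner_gradient hU hguC hφC hc hsU)
      (integrable_inner_gradient hU hYC.continuousOn hφC hc hsU),
      integral_inner_gradient_eq_neg_integral_divergence hU hYC hφC hc hsU] at h1
    have h2 := hweak φ hφC hc hsU hφ0
    simp only [add_mul]
    rw [integral_add (integrable_mul_of_tsupport_subset hU hB hφC.continuous hc hsU)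
      (integrable_mul_of_tsupport_subset hU hdivC hφC.continuous hc hsU)]
    linarith
  have hneg : ∀ x ∈ Metric.ball x₀ r, B x + divergence Y x < 0 := by
    intro x hx
    rw [hYdef, divergence_add_smul_sub
      ((hgV.differentiableOn one_ne_zero).differentiableAt (hU.mem_nhds (hbU hx)))]
    linarith [(hball x hx).2]
  have hx₀b : x₀ ∈ Metric.ball x₀ r := Metric.mem_ball_self hr
  have hpos : 0 < ∫ x, -((B x + divergence Y x) * φ x) := by
    refine Continuous.integral_pos_of_hasCompactSupport_nonneg_nonzero (x := x₀)
      (continuous_mul_of_tsupport_subset hU (hB.add hdivC) hφC.continuous hsU).neg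
      hc.mul_left.neg ?_ ?_
    · intro x
      by_cases hx : x ∈ Metric.ball x₀ r
      · simpa using mul_nonpos_of_nonpos_of_nonneg (hneg x hx).le (hφ0 x)
      · simp [hφdef, Set.indicator_of_notMem hx]
    · refine neg_ne_zero.2 (mul_ne_zero (hneg x₀ hx₀b).ne ?_)
      rw [hφdef, Set.indicator_of_mem hx₀b]
      refine (smoothTransition.pos_of_pos ?_).ne'
      simp only [hh, heq, sub_self, norm_zero]
      have : 0 < η * (r / 2) ^ 2 := by positivity
      simpa using this
  rw [integral_neg] at hpos
  linarith

end TouchingFromAbove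

section SubSolution

variable {N : ℕ} {ρ lam τ θ q : ℝ} {Ω U : Set (EuclideanSpace ℝ (Fin N))}
  {u : EuclideanSpace ℝ (Fin N) → ℝ}

lemma continuousOn_Gt_gradient (hτ1 : τ < 1) (hU : IsOpen U) (hUΩ : U ⊆ Ω \ {0})
    (hu : PosC1 Ω u) : ContinuousOn (fun x => Gt τ x (u x) (gradient u x)) U := by
  have huC := hu.1.mono hUΩ
  have hg := continuousOn_gradient hU huC
  refine ((huC.continuousOn.rpow_const fun x hx => Or.inl (hu.2 x (hUΩ hx)).ne').mul
    (hg.norm.rpow_const fun x _ => Or.inr (by linarith))).div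
    (continuousOn_id.norm.rpow_const fun x hx => Or.inl (norm_ne_zero_iff.2 (hUΩ hx).2)) ?_
  exact fun x hx => (rpow_pos_of_pos (norm_pos_iff.2 (hUΩ hx).2) _).ne'

lemma continuousOn_inner_gradient_div (hU : IsOpen U) (hUΩ : U ⊆ Ω \ {0}) (hu : PosC1 Ω u) :
    ContinuousOn (fun x => ⟪x, gradient u x⟫ / ‖x‖ ^ 2) U :=
  (continuousOn_id.inner (𝕜 := ℝ) (continuousOn_gradient hU (hu.1.mono hUΩ))).div
    (continuousOn_id.norm.pow 2) fun _ hx => pow_ne_zero 2 (norm_ne_zero_iff.2 (hUΩ hx).2)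

lemma continuousOn_norm_rpow_mul_rpow (hUΩ : U ⊆ Ω \ {0}) (hu : PosC1 Ω u) :
    ContinuousOn (fun x => ‖x‖ ^ θ * u x ^ q) U :=
  (continuousOn_id.norm.rpow_const fun _ hx => Or.inl (norm_ne_zero_iff.2 (hUΩ hx).2)).mul
    ((hu.1.mono hUΩ).continuousOn.rpow_const fun x hx => Or.inl (ne_of_gt (hu.2 x (hUΩ hx))))

/-- Sub-solutions are viscosity sub-solutions: if a `C²` function touches a sub-solution from above
at `x₀`, it satisfies the differential inequality at `x₀`. -/
lemma IsSubSolutionE.le_of_touching (hτ1 : τ < 1) (hu : IsSubSolutionE N ρ lam τ θ q Ω u)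
    {V : EuclideanSpace ℝ (Fin N) → ℝ} {x₀ : EuclideanSpace ℝ (Fin N)}
    (hU : IsOpen U) (hUΩ : U ⊆ Ω \ {0}) (hx₀ : x₀ ∈ U) (hV : ContDiffOn ℝ 2 V U)
    (hle : ∀ x ∈ U, u x ≤ V x) (heq : u x₀ = V x₀) :
    ‖x₀‖ ^ θ * V x₀ ^ q ≤ divergence (gradient V) x₀
      - ((N : ℝ) - 2 + 2 * ρ) * (⟪x₀, gradient V x₀⟫ / ‖x₀‖ ^ 2)
      + lam * Gt τ x₀ (V x₀) (gradient V x₀) := by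
  have huC := hu.1.1.mono hUΩ
  have hI := continuousOn_inner_gradient_div hU hUΩ hu.1
  have hG := continuousOn_Gt_gradient hτ1 hU hUΩ hu.1
  have hP := continuousOn_norm_rpow_mul_rpow (θ := θ) (q := q) hUΩ hu.1
  have hgrad : gradient u x₀ = gradient V x₀ := by
    have hn := hU.mem_nhds hx₀
    have h1 := (huC.differentiableOn one_ne_zero).differentiableAt hn
    have h2 := (hV.differentiableOn two_ne_zero).differentiableAt hn
    have hmax : IsLocalMax (u - V) x₀ := by
      filter_upwards [hn] with x hx
      simp only [Pi.sub_apply, heq]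
      linarith [hle x hx]
    have h3 := hmax.fderiv_eq_zero
    rw [fderiv_sub h1 h2, sub_eq_zero] at h3
    simp only [gradient, h3]
  have key := neg_divergence_gradient_le_of_touching (u := u) (V := V)
    (B := fun x => -((N : ℝ) - 2 + 2 * ρ) * (⟪x, gradient u x⟫ / ‖x‖ ^ 2)
      + lam * Gt τ x (u x) (gradient u x) - ‖x‖ ^ θ * u x ^ q) hU hx₀ huC hV
    (((hI.const_mul _).add (hG.const_mul _)).sub hP) ?_ hle heq
  · simp only [hgrad, heq] at key
    linarith
  · intro φ hφ hc hs hφ0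
    have hw := hu.2 φ ⟨hφ, hc, hs.trans hUΩ⟩ hφ0
    have hz : ∀ x, x ∉ Ω \ {0} → φ x = 0 := fun x hx =>
      image_eq_zero_of_notMem_tsupport fun hx' => hx (hUΩ (hs hx'))
    have hzg : ∀ x, x ∉ Ω \ {0} → gradient φ x = 0 := fun x hx => by
      rw [(notMem_tsupport_iff_eventuallyEq.1 fun hx' => hx (hUΩ (hs hx'))).gradient_eq]
      exact gradient_fun_const x (0 : ℝ)
    unfold weakE at hw
    rw [setIntegral_eq_integral_of_forall_compl_eq_zero fun x hx => by simp [hzg x hx],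
      setIntegral_eq_integral_of_forall_compl_eq_zero fun x hx => by simp [hz x hx],
      setIntegral_eq_integral_of_forall_compl_eq_zero fun x hx => by simp [hz x hx],
      setIntegral_eq_integral_of_forall_compl_eq_zero fun x hx => by simp [hz x hx]] at hw
    have hIi := integrable_mul_of_tsupport_subset hU hI hφ.continuous hc hs
    have hGi := integrable_mul_of_tsupport_subset hU hG hφ.continuous hc hs
    have hPi := integrable_mul_of_tsupport_subset hU hP hφ.continuous hc hs
    simp only [sub_mul, add_mul, mul_assoc] at hIi hGi hPi hw ⊢
    rw [integral_sub ((hIi.const_mul _).fun_add (hGi.const_mul _)) hPi,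
      integral_add (hIi.const_mul _) (hGi.const_mul _), integral_const_mul, integral_const_mul]
    linarith

end SubSolution

section Radial

variable {N : ℕ} {x₀ : EuclideanSpace ℝ (Fin N)}

lemma hasFDerivAt_log_norm {x : EuclideanSpace ℝ (Fin N)} (hx : x ≠ 0) :
    HasFDerivAt (fun y : EuclideanSpace ℝ (Fin N) => log ‖y‖) ((‖x‖ ^ 2)⁻¹ • innerSL ℝ x) x := by
  have h1 : HasFDerivAt (fun y : EuclideanSpace ℝ (Fin N) => ‖y‖ ^ 2) (2 • innerSL ℝ x) x := by
    simpa using (hasFDerivAt_id x).norm_sq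
  have hn : ‖x‖ ^ 2 ≠ 0 := pow_ne_zero 2 (norm_ne_zero_iff.2 hx)
  have h2 := (h1.log hn).const_mul (1 / 2)
  have he : (fun y : EuclideanSpace ℝ (Fin N) => log ‖y‖) =
      fun y => 1 / 2 * log (‖y‖ ^ 2) := by
    funext y
    rw [log_pow]
    push_cast
    ring
  rw [he]
  refine h2.congr_fderiv ?_
  ext v
  simp only [smul_apply, innerSL_apply_apply, smul_eq_mul, nsmul_eq_mul,
    Nat.cast_ofNat]
  ring

lemma hasGradientAt_comp_log_norm {H : ℝ → ℝ} {H' : ℝ}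
    {x : EuclideanSpace ℝ (Fin N)} (hx : x ≠ 0) (hH : HasDerivAt H H' (log ‖x‖)) :
    HasGradientAt (fun y : EuclideanSpace ℝ (Fin N) => H (log ‖y‖)) ((H' / ‖x‖ ^ 2) • x) x := by
  rw [hasGradientAt_iff_hasFDerivAt]
  refine (hH.comp_hasFDerivAt x (hasFDerivAt_log_norm hx)).congr_fderiv ?_
  ext v
  simp only [smul_apply, innerSL_apply_apply, smul_eq_mul, map_smul,
    InnerProductSpace.toDual_apply_apply]
  ring

lemma divergence_smul_id {a : EuclideanSpace ℝ (Fin N) → ℝ}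
    {a' : EuclideanSpace ℝ (Fin N) →L[ℝ] ℝ} {x : EuclideanSpace ℝ (Fin N)}
    (ha : HasFDerivAt a a' x) : divergence (fun y => a y • y) x = N * a x + a' x := by
  have h : HasFDerivAt (fun y => a y • y) _ x := ha.smul (hasFDerivAt_id x)
  have hx : a' x = ∑ i, x i * a' (EuclideanSpace.single i 1) := by
    conv_lhs => rw [← (EuclideanSpace.basisFun (Fin N) ℝ).sum_repr x]
    simp
  simp [divergence, h.fderiv, Finset.sum_add_distrib, hx, mul_comm]

/-- The Laplacian of the radial function `H (log ‖x‖)`. -/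
lemma divergence_gradient_comp_log_norm {H H' : ℝ → ℝ} {H'' : ℝ} (hx₀ : x₀ ≠ 0)
    (hH : ∀ᶠ t in 𝓝 (log ‖x₀‖), HasDerivAt H (H' t) t) (hH' : HasDerivAt H' H'' (log ‖x₀‖)) :
    divergence (gradient fun y : EuclideanSpace ℝ (Fin N) => H (log ‖y‖)) x₀ =
      (H'' + ((N : ℝ) - 2) * H' (log ‖x₀‖)) / ‖x₀‖ ^ 2 := by
  have hn : ‖x₀‖ ≠ 0 := norm_ne_zero_iff.2 hx₀
  have hcont : Tendsto (fun y : EuclideanSpace ℝ (Fin N) => log ‖y‖) (𝓝 x₀) (𝓝 (log ‖x₀‖)) :=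
    (hasFDerivAt_log_norm hx₀).continuousAt
  have hev : (gradient fun y : EuclideanSpace ℝ (Fin N) => H (log ‖y‖)) =ᶠ[𝓝 x₀]
      fun y => (H' (log ‖y‖) / ‖y‖ ^ 2) • y := by
    filter_upwards [hcont.eventually hH, isOpen_ne.eventually_mem hx₀] with y hy hy0
    exact (hasGradientAt_comp_log_norm hy0 hy).gradient
  have hsq : HasFDerivAt (fun y : EuclideanSpace ℝ (Fin N) => ‖y‖ ^ 2) (2 • innerSL ℝ x₀) x₀ := by
    simpa using (hasFDerivAt_id x₀).norm_sq
  have ha := (hH'.comp_hasFDerivAt x₀ (hasFDerivAt_log_norm hx₀)).mul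
    ((hasDerivAt_inv (pow_ne_zero 2 hn)).comp_hasFDerivAt x₀ hsq)
  have hdiv := divergence_smul_id ha
  unfold divergence at hdiv ⊢
  rw [hev.fderiv_eq]
  refine hdiv.trans ?_
  simp only [Pi.mul_apply, Function.comp_apply, add_apply,
    smul_apply, innerSL_apply_apply, real_inner_self_eq_norm_sq, smul_eq_mul,
    nsmul_eq_mul, Nat.cast_ofNat]
  field_simp
  ring

end Radial

section Comparison

variable {N : ℕ} {ρ lam τ θ q : ℝ} {Ω U : Set (EuclideanSpace ℝ (Fin N))}
  {u : EuclideanSpace ℝ (Fin N) → ℝ}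

lemma contDiffAt_log_norm {x : EuclideanSpace ℝ (Fin N)} (hx : x ≠ 0) :
    ContDiffAt ℝ 2 (fun y : EuclideanSpace ℝ (Fin N) => log ‖y‖) x :=
  (contDiffAt_norm ℝ hx).log (norm_ne_zero_iff.2 hx)

/-- The differential inequality at a point where `exp (W (log ‖x‖))` touches a sub-solution from
above, written in terms of `W`. -/
lemma IsSubSolutionE.exp_le_of_touching (hτ1 : τ < 1) (hu : IsSubSolutionE N ρ lam τ θ q Ω u)
    {W W₁ : ℝ → ℝ} {W₂ : ℝ} {I : Set ℝ} {x₀ : EuclideanSpace ℝ (Fin N)}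
    (hU : IsOpen U) (hUΩ : U ⊆ Ω \ {0}) (hx₀ : x₀ ∈ U) (hI : IsOpen I)
    (hUI : ∀ x ∈ U, log ‖x‖ ∈ I) (hW : ContDiffOn ℝ 2 W I)
    (hW₁ : ∀ t ∈ I, HasDerivAt W (W₁ t) t) (hW₂ : HasDerivAt W₁ W₂ (log ‖x₀‖))
    (hle : ∀ x ∈ U, u x ≤ exp (W (log ‖x‖))) (heq : u x₀ = exp (W (log ‖x₀‖))) :
    exp ((θ + 2) * log ‖x₀‖ + (q - 1) * W (log ‖x₀‖)) ≤ W₂ + fRho ρ lam τ (-W₁ (log ‖x₀‖)) := by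
  have hx0 : x₀ ≠ 0 := (hUΩ hx₀).2
  have hH : ∀ t ∈ I, HasDerivAt (fun t => exp (W t)) (exp (W t) * W₁ t) t :=
    fun t ht => (hW₁ t ht).exp
  have hH' := (hH _ (hUI x₀ hx₀)).mul hW₂
  have hV : ContDiffOn ℝ 2 (fun x : EuclideanSpace ℝ (Fin N) => exp (W (log ‖x‖))) U := by
    intro x hx
    have h1 := (hW.contDiffAt (hI.mem_nhds (hUI x hx))).comp x (contDiffAt_log_norm (hUΩ hx).2)
    exact h1.exp.contDiffWithinAt
  have key := hu.le_of_touching hτ1 hU hUΩ hx₀ hV hle heq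
  rw [divergence_gradient_comp_log_norm hx0 ((hI.eventually_mem (hUI x₀ hx₀)).mono hH) hH',
    (hasGradientAt_comp_log_norm hx0 (hH _ (hUI x₀ hx₀))).gradient] at key
  set t := log ‖x₀‖ with ht
  have hr : 0 < ‖x₀‖ := norm_pos_iff.2 hx0
  have hG : Gt τ x₀ (exp (W t)) ((exp (W t) * W₁ t / ‖x₀‖ ^ 2) • x₀) =
      exp (W t) * |W₁ t| ^ (1 - τ) / ‖x₀‖ ^ 2 := by
    have hn : ‖(exp (W t) * W₁ t / ‖x₀‖ ^ 2) • x₀‖ = exp (W t) * (|W₁ t| * ‖x₀‖⁻¹) := by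
      rw [norm_smul, Real.norm_eq_abs, abs_div, abs_mul, abs_of_pos (exp_pos _),
        abs_of_pos (pow_pos hr 2)]
      field_simp
    have h1 : exp (W t) ^ τ * exp (W t) ^ (1 - τ) = exp (W t) := by
      rw [← rpow_add (exp_pos _)]
      simp
    have h2 : ‖x₀‖ ^ (1 - τ) * ‖x₀‖ ^ (τ + 1) = ‖x₀‖ ^ 2 := by
      rw [← rpow_add hr, ← rpow_natCast]
      congr 1
      push_cast
      ring
    unfold Gt
    rw [hn, mul_rpow (exp_pos _).le (by positivity), mul_rpow (abs_nonneg _) (by positivity),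
      inv_rpow hr.le, ← h2]
    conv_rhs => rw [← h1]
    field_simp
  have hin : ⟪x₀, (exp (W t) * W₁ t / ‖x₀‖ ^ 2) • x₀⟫ = exp (W t) * W₁ t := by
    rw [real_inner_smul_right, real_inner_self_eq_norm_sq]
    field_simp
  have hexp : exp ((θ + 2) * t + (q - 1) * W t) * exp (W t) =
      ‖x₀‖ ^ θ * exp (W t) ^ q * ‖x₀‖ ^ 2 := by
    have h3 : ‖x₀‖ ^ 2 = exp (t * 2) := by
      rw [exp_mul, ht, exp_log hr]
      norm_cast
    rw [h3, rpow_def_of_pos hr, ← exp_mul, ← exp_add, ← exp_add, ← exp_add]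
    congr 1
    ring
  rw [hG, hin] at key
  have hmul := mul_le_mul_of_nonneg_right key (pow_pos hr 2).le
  rw [← hexp] at hmul
  refine le_of_mul_le_mul_right (hmul.trans_eq ?_) (exp_pos (W t))
  unfold fRho
  rw [abs_neg]
  field_simp
  ring

lemma rpow_le_one_add {a s : ℝ} (ha : 0 ≤ a) (hs0 : 0 ≤ s) (hs1 : s ≤ 1) : a ^ s ≤ 1 + a := by
  rcases le_total a 1 with h | h
  · linarith [rpow_le_one ha h hs0]
  · have := rpow_le_rpow_of_exponent_le h hs1
    rw [rpow_one] at this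
    linarith

lemma continuous_fRho (hτ1 : τ < 1) : Continuous (fRho ρ lam τ) := by
  have : Continuous fun t : ℝ => |t| ^ (1 - τ) :=
    continuous_abs.rpow_const fun _ => Or.inr (by linarith)
  unfold fRho
  fun_prop

/-- `f_ρ` is continuous and grows at most quadratically. -/
lemma exists_fRho_sub_le (hτ0 : 0 ≤ τ) (hτ1 : τ < 1) {b δ : ℝ} (hb : 0 < fRho ρ lam τ b)
    (hδ : 0 < δ) : ∃ C : ℝ, 0 ≤ C ∧ ∀ p, fRho ρ lam τ (b - p) ≤ fRho ρ lam τ b + δ + C * p ^ 2 := by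
  obtain ⟨d, hd, hnear⟩ : ∃ d > 0, ∀ p : ℝ, |p| < d →
      fRho ρ lam τ (b - p) < fRho ρ lam τ b + δ := by
    have hc : ContinuousAt (fun p => fRho ρ lam τ (b - p)) 0 :=
      ((continuous_fRho hτ1).comp (continuous_const.sub continuous_id)).continuousAt
    have := hc.eventually_lt (continuousAt_const (y := fRho ρ lam τ b + δ)) (by simpa using hδ)
    obtain ⟨d, hd, h⟩ := Metric.eventually_nhds_iff.1 this
    exact ⟨d, hd, fun p hp => h (by simpa using hp)⟩
  set K₀ : ℝ := b ^ 2 + 2 * |ρ| * |b| + |lam| * (1 + |b|) with hK₀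
  set K₁ : ℝ := 2 * |b| + 2 * |ρ| + |lam| with hK₁
  refine ⟨K₀ / d ^ 2 + K₁ / d + 1, by positivity, fun p => ?_⟩
  rcases lt_or_ge |p| d with hp | hp
  · have : 0 ≤ (K₀ / d ^ 2 + K₁ / d + 1) * p ^ 2 := by positivity
    linarith [hnear p hp]
  · have h1 : fRho ρ lam τ (b - p) ≤ K₀ + K₁ * |p| + p ^ 2 := by
      have h2 : |b - p| ^ (1 - τ) ≤ 1 + |b - p| :=
        rpow_le_one_add (abs_nonneg _) (by linarith) (by linarith)
      have h3 : |b - p| ≤ |b| + |p| := abs_sub b p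
      have h4 : lam * |b - p| ^ (1 - τ) ≤ |lam| * (1 + |b| + |p|) :=
        mul_le_mul (le_abs_self _) (by linarith) (by positivity) (abs_nonneg _)
      have h5 : ρ * b ≤ |ρ| * |b| := by rw [← abs_mul]; exact le_abs_self _
      have h6 : -(ρ * p) ≤ |ρ| * |p| := by rw [← abs_mul]; exact neg_le_abs _
      have h7 : -(b * p) ≤ |b| * |p| := by rw [← abs_mul]; exact neg_le_abs _
      unfold fRho
      rw [hK₀, hK₁]
      nlinarith
    have h2 : K₀ ≤ K₀ / d ^ 2 * p ^ 2 := by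
      rw [div_mul_eq_mul_div, le_div_iff₀ (by positivity), ← sq_abs p]
      exact mul_le_mul_of_nonneg_left (pow_le_pow_left₀ hd.le hp 2) (by positivity)
    have h3 : K₁ * |p| ≤ K₁ / d * p ^ 2 := by
      rw [div_mul_eq_mul_div, le_div_iff₀ hd, ← sq_abs p, mul_assoc]
      refine mul_le_mul_of_nonneg_left ?_ (by positivity)
      nlinarith [abs_nonneg p]
    linarith

end Comparison

/-- The logarithm of the barrier, in the variable `log ‖x‖`: it blows up at `c - T` and `c + T`. -/
def logBarrier (m b g c T t : ℝ) : ℝ := m - b * t - g * log (1 - ((t - c) / T) ^ 2)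

/-- The derivative of `logBarrier`, up to the summand `-b`. -/
def barrierSlope (g c T t : ℝ) : ℝ := 2 * g / T * (((t - c) / T) / (1 - ((t - c) / T) ^ 2))

section Barrier

variable {m b g c T t : ℝ}

lemma hasDerivAt_one_sub_sq :
    HasDerivAt (fun t => 1 - ((t - c) / T) ^ 2) (-(2 * ((t - c) / T) / T)) t := by
  refine (((((hasDerivAt_id t).sub_const c).div_const T).pow 2).const_sub 1).congr_deriv ?_
  simp
  ring

lemma hasDerivAt_logBarrier (ht : 0 < 1 - ((t - c) / T) ^ 2) :
    HasDerivAt (logBarrier m b g c T) (-(b - barrierSlope g c T t)) t := by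
  refine ((((hasDerivAt_id t).const_mul b).const_sub m).sub
    ((hasDerivAt_one_sub_sq.log ht.ne').const_mul g)).congr_deriv ?_
  unfold barrierSlope
  ring

lemma hasDerivAt_barrierSlope (ht : 0 < 1 - ((t - c) / T) ^ 2) :
    HasDerivAt (fun t => -(b - barrierSlope g c T t))
      (2 * g / T ^ 2 * ((1 + ((t - c) / T) ^ 2) / (1 - ((t - c) / T) ^ 2) ^ 2)) t := by
  have h1 : HasDerivAt (fun t => (t - c) / T) (1 / T) t :=
    ((hasDerivAt_id t).sub_const c).div_const T
  refine ((((h1.div hasDerivAt_one_sub_sq ht.ne').const_mul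
    (2 * g / T)).const_sub b).neg).congr_deriv ?_
  generalize (t - c) / T = s at ht ⊢
  generalize (1 - s ^ 2) ^ 2 = d
  ring

lemma contDiffOn_logBarrier :
    ContDiffOn ℝ 2 (logBarrier m b g c T) {t | 0 < 1 - ((t - c) / T) ^ 2} := by
  unfold logBarrier
  have : ContDiffOn ℝ 2 (fun t => log (1 - ((t - c) / T) ^ 2)) {t | 0 < 1 - ((t - c) / T) ^ 2} :=
    ContDiffOn.log (by fun_prop) fun t ht => (ne_of_gt ht)
  fun_prop

lemma exp_logBarrier_log {M r : ℝ} (hM : 0 < M) (hr : 0 < r)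
    (hD : 0 < 1 - ((log r - c) / T) ^ 2) :
    exp (logBarrier (log M) b g c T (log r)) * (r ^ b * (1 - ((log r - c) / T) ^ 2) ^ g) = M := by
  rw [rpow_def_of_pos hr, rpow_def_of_pos hD, ← exp_add, ← exp_add]
  conv_rhs => rw [← exp_log hM]
  congr 1
  unfold logBarrier
  ring

/-- The barrier is a strict super-solution once `T` is large. -/
lemma barrier_lt {A C F δ : ℝ} (hC : 0 ≤ C) (hF : 0 ≤ F) (hδ : 0 < δ) (hg : 0 ≤ g) (hT : 0 < T)
    (hA : F + 2 * δ < A) (hK : 4 * g + 4 * C * g ^ 2 ≤ δ * T ^ 2)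
    (ht : 0 < 1 - ((t - c) / T) ^ 2) :
    2 * g / T ^ 2 * ((1 + ((t - c) / T) ^ 2) / (1 - ((t - c) / T) ^ 2) ^ 2)
      + (F + δ + C * barrierSlope g c T t ^ 2) < A / (1 - ((t - c) / T) ^ 2) ^ 2 := by
  unfold barrierSlope
  set s := (t - c) / T with hs
  have hD : 0 < (1 - s ^ 2) ^ 2 := by positivity
  have hs2 : 0 ≤ s ^ 2 := sq_nonneg s
  rw [lt_div_iff₀ hD]
  have e : (2 * g / T ^ 2 * ((1 + s ^ 2) / (1 - s ^ 2) ^ 2)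
      + (F + δ + C * (2 * g / T * (s / (1 - s ^ 2))) ^ 2)) * (1 - s ^ 2) ^ 2
      = (2 * g * (1 + s ^ 2) + 4 * C * g ^ 2 * s ^ 2) / T ^ 2 + (F + δ) * (1 - s ^ 2) ^ 2 := by
    have := ht.ne'
    field_simp
    ring
  rw [e]
  have h1 : (2 * g * (1 + s ^ 2) + 4 * C * g ^ 2 * s ^ 2) / T ^ 2 ≤ δ := by
    rw [div_le_iff₀ (by positivity)]
    have : C * g ^ 2 * s ^ 2 ≤ C * g ^ 2 * 1 :=
      mul_le_mul_of_nonneg_left (by linarith) (by positivity)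
    have : g * s ^ 2 ≤ g * 1 := mul_le_mul_of_nonneg_left (by linarith) hg
    nlinarith
  have h2 : (1 - s ^ 2) ^ 2 ≤ 1 := pow_le_one₀ ht.le (by linarith)
  have h3 : (F + δ) * (1 - s ^ 2) ^ 2 ≤ F + δ := mul_le_of_le_one_right (by positivity) h2
  linarith

end Barrier

section Comparison

variable {N : ℕ} {ρ lam τ θ q : ℝ} {Ω : Set (EuclideanSpace ℝ (Fin N))}
  {u : EuclideanSpace ℝ (Fin N) → ℝ}

/-- Comparison of a sub-solution with the barrier on an annulus. -/
lemma IsSubSolutionE.norm_rpow_mul_le (hτ1 : τ < 1) (hq : 1 < q) (hΩ : IsOpen Ω)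
    (hu : IsSubSolutionE N ρ lam τ θ q Ω u) {A C δ T : ℝ}
    (hf : 0 < fRho ρ lam τ ((θ + 2) / (q - 1))) (hA : 0 < A) (hC : 0 ≤ C) (hδ : 0 < δ) (hT : 0 < T)
    (hAδ : fRho ρ lam τ ((θ + 2) / (q - 1)) + 2 * δ ≤ A ^ (q - 1))
    (hfC : ∀ p, fRho ρ lam τ ((θ + 2) / (q - 1) - p) ≤
      fRho ρ lam τ ((θ + 2) / (q - 1)) + δ + C * p ^ 2)
    (hK : 4 * (2 / (q - 1)) + 4 * C * (2 / (q - 1)) ^ 2 ≤ δ * T ^ 2)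
    {x : EuclideanSpace ℝ (Fin N)} (hx : x ≠ 0)
    (hball : Metric.closedBall 0 (exp (log ‖x‖ + T)) ⊆ Ω) :
    ‖x‖ ^ ((θ + 2) / (q - 1)) * u x ≤ A := by
  have hq1 : 0 < q - 1 := by linarith
  set b := (θ + 2) / (q - 1) with hb
  set g := 2 / (q - 1) with hg
  set c := log ‖x‖ with hc
  have hg0 : 0 < g := by positivity
  have hbq : θ + 2 = (q - 1) * b := by rw [hb]; field_simp
  have hgq : (q - 1) * g = 2 := by rw [hg]; field_simp
  by_contra! hlt
  set D : EuclideanSpace ℝ (Fin N) → ℝ := fun z => 1 - ((log ‖z‖ - c) / T) ^ 2 with hD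
  set K : Set (EuclideanSpace ℝ (Fin N)) :=
    Metric.closedBall 0 (exp (c + T)) ∩ {z | exp (c - T) ≤ ‖z‖} with hKdef
  set U : Set (EuclideanSpace ℝ (Fin N)) := (Ω \ {0}) ∩ D ⁻¹' Set.Ioi 0 with hUdef
  have hKΩ : K ⊆ Ω \ {0} := fun z hz =>
    ⟨hball hz.1, norm_pos_iff.1 ((exp_pos _).trans_le hz.2)⟩
  have hDcont : ContinuousOn D (Ω \ {0}) := by
    have : ContinuousOn (fun z : EuclideanSpace ℝ (Fin N) => log ‖z‖) (Ω \ {0}) :=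
      continuousOn_id.norm.log fun z hz => norm_ne_zero_iff.2 hz.2
    fun_prop
  have hUo : IsOpen U := hDcont.isOpen_inter_preimage
    (hΩ.sdiff isClosed_singleton) isOpen_Ioi
  have hKc : IsCompact K :=
    (isCompact_closedBall _ _).inter_right (isClosed_le continuous_const continuous_norm)
  have hKiff : ∀ z, z ≠ 0 → (z ∈ K ↔ 0 ≤ D z) := by
    intro z hz
    have hz' := norm_pos_iff.2 hz
    rw [hKdef, Set.mem_inter_iff, mem_closedBall_zero_iff, Set.mem_ofPred_eq,
      ← log_le_iff_le_exp hz', ← le_log_iff_exp_le hz']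
    simp only [hD]
    rw [sub_nonneg, sq_le_one_iff_abs_le_one, abs_le, le_div_iff₀ hT, div_le_iff₀ hT]
    constructor <;> rintro ⟨h1, h2⟩ <;> constructor <;> linarith
  set f : EuclideanSpace ℝ (Fin N) → ℝ := fun z => ‖z‖ ^ b * u z * D z ^ g with hfdef
  have hfcont : ContinuousOn f K :=
    (((continuousOn_id.norm.rpow_const fun z hz => Or.inl (norm_ne_zero_iff.2 hz.2)).mul
      hu.1.1.continuousOn).mul (hDcont.rpow_const fun z _ => Or.inr hg0.le)).mono hKΩ
  have hDx : D x = 1 := by simp [hD, hc]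
  have hxK : x ∈ K := (hKiff x hx).2 (by rw [hDx]; exact zero_le_one)
  obtain ⟨x₀, hx₀K, hmax⟩ := hKc.exists_isMaxOn ⟨x, hxK⟩ hfcont
  have hM : A < f x₀ := by
    refine hlt.trans_le ((le_of_eq ?_).trans (hmax hxK))
    simp [hfdef, hDx]
  have hM0 : 0 < f x₀ := hA.trans hM
  have hx₀ : x₀ ≠ 0 := (hKΩ hx₀K).2
  have hDx₀ : 0 < D x₀ := by
    refine ((hKiff x₀ hx₀).1 hx₀K).lt_of_ne fun h => hM0.ne' ?_
    simp [hfdef, ← h, zero_rpow hg0.ne']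
  have hexp : ∀ z ∈ U, exp (logBarrier (log (f x₀)) b g c T (log ‖z‖)) * (‖z‖ ^ b * D z ^ g) =
      f x₀ := fun z hz => exp_logBarrier_log hM0 (norm_pos_iff.2 hz.1.2) hz.2
  have hpos : ∀ z ∈ U, 0 < ‖z‖ ^ b * D z ^ g := fun z hz =>
    mul_pos (rpow_pos_of_pos (norm_pos_iff.2 hz.1.2) _) (rpow_pos_of_pos hz.2 _)
  have hx₀U : x₀ ∈ U := ⟨hKΩ hx₀K, hDx₀⟩
  have key := hu.exp_le_of_touching hτ1 (W := logBarrier (log (f x₀)) b g c T) hUo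
    Set.inter_subset_left hx₀U (I := {t | 0 < 1 - ((t - c) / T) ^ 2})
    (isOpen_lt continuous_const (by fun_prop)) (fun z hz => hz.2) contDiffOn_logBarrier
    (fun t ht => hasDerivAt_logBarrier ht) (hasDerivAt_barrierSlope hDx₀) ?_ ?_
  · rw [neg_neg] at key
    have hlhs : exp ((θ + 2) * log ‖x₀‖ + (q - 1) * logBarrier (log (f x₀)) b g c T (log ‖x₀‖)) =
        f x₀ ^ (q - 1) / D x₀ ^ 2 := by
      have h1 : D x₀ ^ 2 = exp (2 * log (D x₀)) := by
        rw [mul_comm, exp_mul, exp_log hDx₀]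
        norm_cast
      rw [h1, rpow_def_of_pos hM0, ← exp_sub]
      congr 1
      simp only [logBarrier, hbq, hD]
      linear_combination (-log (1 - ((log ‖x₀‖ - c) / T) ^ 2)) * hgq
    rw [hlhs] at key
    have h2 : fRho ρ lam τ b + 2 * δ < f x₀ ^ (q - 1) :=
      hAδ.trans_lt (rpow_lt_rpow hA.le hM hq1)
    have h3 := barrier_lt hC hf.le hδ hg0.le hT h2 hK hDx₀
    have h4 := hfC (barrierSlope g c T (log ‖x₀‖))
    simp only [hD] at key
    linarith
  · intro z hz
    refine le_of_mul_le_mul_right ?_ (hpos z hz)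
    rw [hexp z hz]
    have := hmax ((hKiff z hz.1.2).2 (le_of_lt hz.2))
    refine le_trans (le_of_eq ?_) this
    simp only [hfdef]
    ring
  · refine mul_right_cancel₀ (hpos x₀ hx₀U).ne' ?_
    rw [hexp x₀ hx₀U]
    simp only [hfdef]
    ring

end Comparison

/-- If `f_ρ(β) > 0`, every positive sub-solution `u` of (E) in `Ω \ {0}`
satisfies `limsup_{|x|→0} |x|^β u(x) ≤ Λ`, i.e. for every `ε > 0` eventually
`|x|^β u(x) ≤ Λ + ε` as `x → 0`, where `Λ = f_ρ(β)^{1/(q-1)}`. -/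
theorem stmt5_limsup_le_Lambda
    (N : ℕ) (hN : 2 ≤ N) (ρ lam τ θ q : ℝ)
    (hτ0 : 0 ≤ τ) (hτ1 : τ < 1) (hq : 1 < q)
    (Ω : Set (EuclideanSpace ℝ (Fin N))) (hΩ : IsOpen Ω) (h0 : (0 : EuclideanSpace ℝ (Fin N)) ∈ Ω)
    (hf : 0 < fRho ρ lam τ ((θ + 2) / (q - 1)))
    (u : EuclideanSpace ℝ (Fin N) → ℝ)
    (hu : IsSubSolutionE N ρ lam τ θ q Ω u) :
    ∀ ε : ℝ, 0 < ε → ∀ᶠ x in 𝓝[≠] (0 : EuclideanSpace ℝ (Fin N)),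
      ‖x‖ ^ ((θ + 2) / (q - 1)) * u x ≤
        (fRho ρ lam τ ((θ + 2) / (q - 1))) ^ (1 / (q - 1)) + ε := by
  intro ε hε
  set b := (θ + 2) / (q - 1) with hb
  have hq1 : 0 < q - 1 := by linarith
  have hΛ : 0 < fRho ρ lam τ b ^ (1 / (q - 1)) := rpow_pos_of_pos hf _
  set A := fRho ρ lam τ b ^ (1 / (q - 1)) + ε with hA
  have hA0 : 0 < A := by positivity
  obtain ⟨δ, hδ, hAδ⟩ : ∃ δ > 0, fRho ρ lam τ b + 2 * δ ≤ A ^ (q - 1) := by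
    have h1 : (fRho ρ lam τ b ^ (1 / (q - 1))) ^ (q - 1) < A ^ (q - 1) :=
      rpow_lt_rpow hΛ.le (by linarith) hq1
    rw [← rpow_mul hf.le, one_div_mul_cancel hq1.ne', rpow_one] at h1
    exact ⟨(A ^ (q - 1) - fRho ρ lam τ b) / 2, by linarith, by linarith⟩
  obtain ⟨C, hC, hfC⟩ := exists_fRho_sub_le hτ0 hτ1 hf hδ
  set k := 4 * (2 / (q - 1)) + 4 * C * (2 / (q - 1)) ^ 2 with hk
  have hk0 : 0 ≤ k := by positivity
  have hK : k ≤ δ * (1 + k / δ) ^ 2 := by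
    have h1 : δ * (k / δ) = k := by field_simp
    have h2 : 0 ≤ k / δ := by positivity
    nlinarith
  obtain ⟨R, hR, hball⟩ := Metric.isOpen_iff.1 hΩ 0 h0
  have hr : 0 < R * exp (-(1 + k / δ)) := by positivity
  filter_upwards [self_mem_nhdsWithin, mem_nhdsWithin_of_mem_nhds (Metric.ball_mem_nhds 0 hr)]
    with x hx hxr
  refine hu.norm_rpow_mul_le hτ1 hq hΩ hf hA0 hC hδ (by positivity) hAδ hfC hK hx
    ((Metric.closedBall_subset_ball ?_).trans hball)
  rw [mem_ball_zero_iff, exp_neg, ← div_eq_mul_inv, lt_div_iff₀ (exp_pos _)] at hxr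
  rwa [exp_add, exp_log (norm_pos_iff.2 hx)]

end
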